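/- Let q be a power of an odd prime and let n, d, s be integers with 1 ≤ d < n−1 and 0 ≤ 2s ≤ d. Then the number of irreducible characters of R_u^{D,d} of degree q^{2(n−d)s} equals q^{2d(n−d)−4(n−d)s} times the number of skew-symmetric d×d matrices over 𝔽_q of rank 2s. Moreover, every irreducible character of R_u^{D,d} has degree q^{2(n−d)s} for some integer s with 0 ≤ 2s ≤ d. -/

import Mathlib

open Matrix

namespace SOUnipotentRadical

/-- The index type for `n×n` matrices, split as `d + (n−d)`. -/
abbrev ι (n d : ℕ) := Fin d ⊕ Fin (n - d)

/-- The index type for `2n×2n` matrices, split as `n + n`. -/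
abbrev κ (n d : ℕ) := ι n d ⊕ ι n d

/-- `U(A) = [[I_d, A],[0, I_{n−d}]]`. -/
def Umat (F : Type) [Field F] (n d : ℕ) (A : Matrix (Fin d) (Fin (n - d)) F) :
    Matrix (ι n d) (ι n d) F :=
  Matrix.fromBlocks 1 A 0 1

/-- `K_d`: skew-symmetric `n×n` matrices whose lower-right `(n−d)×(n−d)` block is zero. -/
def Kd (F : Type) [Field F] (n d : ℕ) : Set (Matrix (ι n d) (ι n d) F) :=
  {V | Vᵀ = -V ∧ ∀ i j, V (Sum.inr i) (Sum.inr j) = 0}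

/-- `R_u^{D,d} = { [[U(A), V·U(A)⁻ᵀ],[0, U(A)⁻ᵀ]] | A ∈ Mat_{d×(n−d)}, V ∈ K_d }`. -/
def RuD (F : Type) [Field F] (n d : ℕ) : Set (Matrix (κ n d) (κ n d) F) :=
  {g | ∃ (A : Matrix (Fin d) (Fin (n - d)) F) (V : Matrix (ι n d) (ι n d) F),
    V ∈ Kd F n d ∧
    g = Matrix.fromBlocks (Umat F n d A) (V * ((Umat F n d A)ᵀ)⁻¹) 0 ((Umat F n d A)ᵀ)⁻¹}

end SOUnipotentRadical

section HeisenbergGroups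

open CategoryTheory

/-- Coordinates on a group `G` of Heisenberg type. -/
structure HeisenbergChart (G W Z : Type*) [Group G] [AddCommGroup W] [AddCommGroup Z] where
  /-- The coordinates of a group element. -/
  coord : G ≃ W × Z
  /-- The cocycle. -/
  form : W →+ W →+ Z
  form_self : ∀ w, form w w = 0
  fst_mul : ∀ g h, (coord (g * h)).1 = (coord g).1 + (coord h).1
  snd_mul : ∀ g h, (coord (g * h)).2 =
    (coord g).2 + (coord h).2 + form (coord g).1 (coord h).1

namespace HeisenbergChart

section Coordinates

variable {G W Z : Type*} [Group G] [AddCommGroup W] [AddCommGroup Z] (H : HeisenbergChart G W Z)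

/-- The group element with given coordinates. -/
def elt (w : W) (z : Z) : G := H.coord.symm (w, z)

@[simp] lemma coord_elt (w : W) (z : Z) : H.coord (H.elt w z) = (w, z) := by simp [elt]

lemma elt_coord (g : G) : H.elt (H.coord g).1 (H.coord g).2 = g := by simp [elt]

lemma ext_coord {g h : G} (h₁ : (H.coord g).1 = (H.coord h).1)
    (h₂ : (H.coord g).2 = (H.coord h).2) : g = h :=
  H.coord.injective (Prod.ext h₁ h₂)

lemma form_swap (w w' : W) : H.form w' w = -H.form w w' := by
  have h := H.form_self (w + w')
  simp only [map_add, AddMonoidHom.add_apply, H.form_self, zero_add, add_zero] at h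
  exact eq_neg_of_add_eq_zero_left h

@[simp] lemma fst_one : (H.coord 1).1 = 0 := by
  simpa using H.fst_mul 1 1

@[simp] lemma snd_one : (H.coord 1).2 = 0 := by
  simpa using H.snd_mul 1 1

lemma fst_inv (g : G) : (H.coord g⁻¹).1 = -(H.coord g).1 := by
  have h := H.fst_mul g⁻¹ g
  rw [inv_mul_cancel, fst_one] at h
  exact eq_neg_of_add_eq_zero_left h.symm

lemma elt_mul_elt (w w' : W) (z z' : Z) :
    H.elt w z * H.elt w' z' = H.elt (w + w') (z + z' + H.form w w') :=
  H.ext_coord (by simp [H.fst_mul]) (by simp [H.snd_mul])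

lemma elt_zero_mul_elt_zero (z z' : Z) : H.elt 0 z * H.elt 0 z' = H.elt 0 (z + z') := by
  simp [elt_mul_elt]

lemma elt_zero_zero : H.elt 0 0 = 1 := H.ext_coord (by simp) (by simp)

lemma mul_eq_mul_mul_elt (g h : G) :
    g * h = h * g * H.elt 0 (H.form (H.coord g).1 (H.coord h).1 +
      H.form (H.coord g).1 (H.coord h).1) :=
  H.ext_coord (by simp [H.fst_mul, add_comm])
    (by simp [H.snd_mul, H.fst_mul, H.form_swap (H.coord g).1 (H.coord h).1]; abel)

lemma commute_elt_zero (z : Z) (h : G) : Commute (H.elt 0 z) h := by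
  rw [Commute, SemiconjBy, H.mul_eq_mul_mul_elt]
  simp [elt_zero_zero]

/-- The radical of the form composed with a character of `Z`. -/
def radical (ψ : AddChar Z ℂ) : AddSubgroup W where
  carrier := {w | ∀ w', ψ (H.form w w') = 1}
  add_mem' {a b} ha hb w' := by simp [AddChar.map_add_eq_mul, ha w', hb w']
  zero_mem' w' := by simp
  neg_mem' {a} ha w' := by simpa using ha (-w')

lemma mem_radical {ψ : AddChar Z ℂ} {w : W} :
    w ∈ H.radical ψ ↔ ∀ w', ψ (H.form w w') = 1 := Iff.rfl

open Classical in
/-- The linear character of the preimage of the radical of `ψ` attached to `ψ` and a character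
`ν` of the radical, extended by zero to the whole group. -/
noncomputable def linChar (ψ : AddChar Z ℂ) (ν : AddChar (H.radical ψ) ℂ) (g : G) : ℂ :=
  if h : (H.coord g).1 ∈ H.radical ψ then ν ⟨_, h⟩ * ψ (H.coord g).2 else 0

variable {H}

lemma linChar_of_mem {ψ : AddChar Z ℂ} (ν : AddChar (H.radical ψ) ℂ) {g : G}
    (h : (H.coord g).1 ∈ H.radical ψ) :
    H.linChar ψ ν g = ν ⟨_, h⟩ * ψ (H.coord g).2 := dif_pos h

lemma linChar_of_notMem {ψ : AddChar Z ℂ} (ν : AddChar (H.radical ψ) ℂ) {g : G}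
    (h : (H.coord g).1 ∉ H.radical ψ) : H.linChar ψ ν g = 0 := dif_neg h

@[simp] lemma linChar_one (ψ : AddChar Z ℂ) (ν : AddChar (H.radical ψ) ℂ) :
    H.linChar ψ ν 1 = 1 := by
  have h : (H.coord 1).1 ∈ H.radical ψ := by simp [zero_mem]
  have h0 : (⟨(H.coord 1).1, h⟩ : H.radical ψ) = 0 := Subtype.ext H.fst_one
  rw [linChar_of_mem ν h, h0, H.snd_one]
  simp

lemma linChar_mul {ψ : AddChar Z ℂ} (ν : AddChar (H.radical ψ) ℂ) {g : G}
    (hg : (H.coord g).1 ∈ H.radical ψ) (h : G) :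
    H.linChar ψ ν (g * h) = H.linChar ψ ν g * H.linChar ψ ν h := by
  by_cases hh : (H.coord h).1 ∈ H.radical ψ
  · have hgh : (H.coord (g * h)).1 ∈ H.radical ψ := by
      rw [H.fst_mul]; exact add_mem hg hh
    have e : (⟨_, hgh⟩ : H.radical ψ) = ⟨_, hg⟩ + ⟨_, hh⟩ := Subtype.ext (H.fst_mul g h)
    rw [linChar_of_mem ν hg, linChar_of_mem ν hh, linChar_of_mem ν hgh, e, H.snd_mul]
    simp only [AddChar.map_add_eq_mul, hg _]
    ring
  · have hgh : (H.coord (g * h)).1 ∉ H.radical ψ := by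
      rw [H.fst_mul]; exact fun h' => hh ((add_mem_cancel_left hg).1 h')
    rw [linChar_of_notMem ν hh, linChar_of_notMem ν hgh, mul_zero]

lemma linChar_elt_zero {ψ : AddChar Z ℂ} (ν : AddChar (H.radical ψ) ℂ) (z : Z) :
    H.linChar ψ ν (H.elt 0 z) = ψ z := by
  have h : (H.coord (H.elt 0 z)).1 ∈ H.radical ψ := by simp [zero_mem]
  have h0 : (⟨(H.coord (H.elt 0 z)).1, h⟩ : H.radical ψ) = 0 := Subtype.ext (by simp)
  rw [linChar_of_mem ν h, h0]
  simp

lemma linChar_conj {ψ : AddChar Z ℂ} (ν : AddChar (H.radical ψ) ℂ) {g : G}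
    (hg : (H.coord g).1 ∈ H.radical ψ) (h : G) :
    H.linChar ψ ν (h * g * h⁻¹) = H.linChar ψ ν g := by
  have e : h * g * h⁻¹ = g * H.elt 0 (H.form (H.coord h).1 (H.coord g).1 +
      H.form (H.coord h).1 (H.coord g).1) := by
    rw [H.mul_eq_mul_mul_elt h g, mul_inv_eq_iff_eq_mul, mul_assoc, mul_assoc,
      (H.commute_elt_zero _ h).eq]
  rw [e, linChar_mul ν hg, linChar_elt_zero, H.form_swap (H.coord g).1, AddChar.map_add_eq_mul,
    AddChar.map_neg_eq_inv, hg]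
  simp

variable (H) in
/-- The pair `(ψ, ν)` can be recovered from a nonzero multiple of `linChar`. -/
lemma smul_linChar_injective {c : ℂ} (hc : c ≠ 0) :
    Function.Injective fun x : Σ ψ : AddChar Z ℂ, AddChar (H.radical ψ) ℂ =>
      c • H.linChar x.1 x.2 := by
  rintro ⟨ψ, ν⟩ ⟨ψ', ν'⟩ h
  have h : H.linChar ψ ν = H.linChar ψ' ν' := smul_right_injective _ hc h
  obtain rfl : ψ = ψ' := by
    ext z
    simpa [linChar_elt_zero] using congrFun h (H.elt 0 z)
  congr 1
  ext w
  have h' := congrFun h (H.elt w.1 0)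
  have hw : (H.coord (H.elt w.1 0)).1 ∈ H.radical ψ := by simp
  rw [linChar_of_mem ν hw, linChar_of_mem ν' hw] at h'
  simpa using h'

end Coordinates

end HeisenbergChart

namespace FDRep

variable {k G : Type} [Field k] [Group G]

/-- Schur's lemma: a group element whose action commutes with the whole group acts on a simple
representation by a scalar. -/
lemma exists_rho_eq_smul_one [IsAlgClosed k] (V : FDRep k G) [Simple V] (g : G)
    (hg : ∀ h, V.ρ g * V.ρ h = V.ρ h * V.ρ g) : ∃ c : k, V.ρ g = c • 1 := by
  let f : V ⟶ V := ⟨InducedCategory.homMk (ModuleCat.ofHom (V.ρ g)), fun h => by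
    ext x
    exact LinearMap.congr_fun (hg h) x⟩
  obtain ⟨c, hc⟩ := endomorphism_simple_eq_smul_id k f
  refine ⟨c, ?_⟩
  have := congrArg (fun u : V ⟶ V => u.hom.hom.hom) hc
  exact this.symm

/-- A monomorphism of finite-dimensional representations is injective. -/
lemma injective_of_mono {V W : FDRep k G} (f : V ⟶ W) [Mono f] :
    Function.Injective f.hom.hom.hom := by
  have : Mono ((Action.forget (FGModuleCat k) G ⋙ forget₂ (FGModuleCat k) (ModuleCat k)).map f) :=
    inferInstance
  exact (ModuleCat.mono_iff_injective _).1 this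

/-- A bijective morphism of finite-dimensional representations is an isomorphism. -/
lemma isIso_of_bijective {V W : FDRep k G} (f : V ⟶ W)
    (hf : Function.Bijective f.hom.hom.hom) : IsIso f := by
  have : IsIso ((Action.forget (FGModuleCat k) G ⋙ forget₂ (FGModuleCat k) (ModuleCat k)).map f) :=
    (ConcreteCategory.isIso_iff_bijective _).2 hf
  exact isIso_of_reflects_iso f (Action.forget (FGModuleCat k) G ⋙
    forget₂ (FGModuleCat k) (ModuleCat k))

lemma hom_rho_apply {V W : FDRep k G} (f : V ⟶ W) (g : G) (v : V) :
    f.hom.hom.hom (V.ρ g v) = W.ρ g (f.hom.hom.hom v) := by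
  have := congrArg (fun u => u.hom.hom) (f.comm g)
  exact LinearMap.congr_fun this v

/-- A property of representations inherited by subrepresentations and satisfied by some nonzero
representation is satisfied by some simple representation. -/
lemma exists_simple_of_exists_nontrivial (P : FDRep k G → Prop)
    (hP : ∀ (U V : FDRep k G) (f : U ⟶ V), Function.Injective f.hom.hom.hom → P V → P U)
    (hV : ∃ V, P V ∧ 0 < Module.finrank k V) : ∃ V, P V ∧ Simple V := by
  classical
  have hex : ∃ n, ∃ V, P V ∧ 0 < Module.finrank k V ∧ Module.finrank k V = n := by
    obtain ⟨V, h, h'⟩ := hV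
    exact ⟨_, V, h, h', rfl⟩
  obtain ⟨V, hPV, hpos, hn⟩ := Nat.find_spec hex
  refine ⟨V, hPV, ⟨fun {U} f _ => ⟨?_, fun hf => ?_⟩⟩⟩
  · rintro hiso rfl
    obtain ⟨v, hv⟩ := Module.finrank_pos_iff_exists_ne_zero.1 hpos
    have e : inv (0 : U ⟶ V) ≫ (0 : U ⟶ V) = 𝟙 V := IsIso.inv_hom_id _
    rw [Limits.comp_zero] at e
    exact hv (LinearMap.congr_fun (congrArg (fun u : V ⟶ V => u.hom.hom.hom) e) v).symm
  · have hinj := injective_of_mono f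
    have hUpos : 0 < Module.finrank k U := by
      rw [Nat.pos_iff_ne_zero]
      intro h0
      have := Module.finrank_zero_iff.1 h0
      apply hf
      ext x
      rw [Subsingleton.elim x 0]
      exact (map_zero f.hom.hom.hom).trans (map_zero (0 : U ⟶ V).hom.hom.hom).symm
    have hle := Nat.find_min' hex ⟨U, hP U V f hinj hPV, hUpos, rfl⟩
    have heq : Module.finrank k U = Module.finrank k V :=
      le_antisymm (LinearMap.finrank_le_finrank_of_injective hinj) (hn ▸ hle)
    exact isIso_of_bijective f
      ⟨hinj, (LinearMap.injective_iff_surjective_of_finrank_eq_finrank heq).1 hinj⟩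

end FDRep

namespace HeisenbergChart

section Characters

variable {G W Z : Type} [Group G] [AddCommGroup W] [AddCommGroup Z] {H : HeisenbergChart G W Z}

variable (H) in
/-- The preimage of the radical of `ψ` acts on `V` through `linChar`. -/
def ActsByLinChar (ψ : AddChar Z ℂ) (ν : AddChar (H.radical ψ) ℂ) (V : FDRep ℂ G) : Prop :=
  ∀ g, (H.coord g).1 ∈ H.radical ψ → V.ρ g = H.linChar ψ ν g • 1

lemma smul_one_injective (V : FDRep ℂ G) [Simple V] {a b : ℂ}
    (h : a • (1 : V →ₗ[ℂ] V) = b • 1) : a = b := by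
  have hV : (1 : V →ₗ[ℂ] V) ≠ 0 := fun h0 => by
    refine id_nonzero V ?_
    ext x
    exact LinearMap.congr_fun h0 x
  exact smul_left_injective ℂ hV h

variable (H) in
/-- A simple representation has a central character, and the preimage of the radical of the
central character acts by scalars. -/
lemma exists_actsByLinChar (V : FDRep ℂ G) [Simple V] :
    ∃ ψ ν, H.ActsByLinChar ψ ν V := by
  have hc : ∀ z, ∃ c : ℂ, V.ρ (H.elt 0 z) = c • 1 := fun z =>
    V.exists_rho_eq_smul_one _ fun h => by
      rw [← map_mul, ← map_mul, (H.commute_elt_zero z h).eq]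
  choose ψ hψ using hc
  let ψ' : AddChar Z ℂ :=
    { toFun := ψ
      map_zero_eq_one' := smul_one_injective V <| by
        rw [← hψ, H.elt_zero_zero, map_one, one_smul]
      map_add_eq_mul' := fun a b => smul_one_injective V <| by
        rw [← hψ, ← H.elt_zero_mul_elt_zero, map_mul, hψ, hψ, smul_mul_smul_comm, one_mul] }
  have hψ' : ∀ z, V.ρ (H.elt 0 z) = ψ' z • 1 := hψ
  have hd : ∀ w : H.radical ψ', ∃ c : ℂ, V.ρ (H.elt w 0) = c • 1 := fun w =>
    V.exists_rho_eq_smul_one _ fun h => by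
      rw [← map_mul, ← map_mul, H.mul_eq_mul_mul_elt, map_mul V.ρ (h * _), hψ',
        AddChar.map_add_eq_mul]
      simp only [coord_elt]
      rw [w.2]
      simp
  choose ν hν using hd
  let ν' : AddChar (H.radical ψ') ℂ :=
    { toFun := ν
      map_zero_eq_one' := smul_one_injective V <| by
        rw [← hν, AddSubgroup.coe_zero, H.elt_zero_zero, map_one, one_smul]
      map_add_eq_mul' := fun a b => smul_one_injective V <| by
        have h1 : V.ρ (H.elt (a + b) 0) = V.ρ (H.elt a 0) * V.ρ (H.elt b 0) := by
          have e : H.elt (a : W) 0 * H.elt (b : W) 0 =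
              H.elt ((a : W) + b) 0 * H.elt 0 (H.form a b) := by
            simp [elt_mul_elt]
          rw [← map_mul, e, map_mul, hψ', a.2, one_smul, mul_one]
        rw [← hν, AddSubgroup.coe_add, h1, hν, hν, smul_mul_smul_comm, one_mul] }
  refine ⟨ψ', ν', fun g hg => ?_⟩
  have e : g = H.elt (H.coord g).1 0 * H.elt 0 (H.coord g).2 := by
    simp [elt_mul_elt, elt_coord]
  rw [linChar_of_mem ν' hg]
  conv_lhs => rw [e]
  rw [map_mul, hψ', hν ⟨_, hg⟩, smul_mul_smul_comm, one_mul]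
  rfl

/-- If `W` is `2`-divisible, the character of a representation on which the preimage of
the radical acts by scalars is determined by these scalars. -/
lemma ActsByLinChar.character_eq (h2 : ∀ w : W, ∃ w', w' + w' = w) {ψ : AddChar Z ℂ}
    {ν : AddChar (H.radical ψ) ℂ} {V : FDRep ℂ G} (hV : H.ActsByLinChar ψ ν V) :
    V.character = (Module.finrank ℂ V : ℂ) • H.linChar ψ ν := by
  funext g
  by_cases hg : (H.coord g).1 ∈ H.radical ψ
  · simp [FDRep.character, hV g hg, mul_comm]
  · rw [Pi.smul_apply, linChar_of_notMem ν hg, smul_zero]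
    simp only [mem_radical, not_forall] at hg
    obtain ⟨w, hw⟩ := hg
    obtain ⟨w', rfl⟩ := h2 w
    set h := H.elt w' 0
    have hz : ∀ z, V.ρ (H.elt 0 z) = ψ z • 1 := fun z => by
      rw [hV _ (by simp [zero_mem]), linChar_elt_zero]
    have key : V.character g = ψ (H.form (H.coord g).1 (w' + w')) * V.character g := by
      conv_lhs => rw [← V.char_conj g h⁻¹, inv_inv, mul_assoc, H.mul_eq_mul_mul_elt g h, mul_assoc,
        inv_mul_cancel_left]
      rw [FDRep.character, map_mul, hz]
      simp [h, FDRep.character]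
    by_contra hne
    exact hw (mul_right_cancel₀ hne (by rw [← key, one_mul]))

variable [Finite G]

variable (H) in
/-- Some nonzero representation has the preimage of the radical acting through `linChar`: the
representation coinduced from it. -/
lemma exists_actsByLinChar_nontrivial (ψ : AddChar Z ℂ) (ν : AddChar (H.radical ψ) ℂ) :
    ∃ V, H.ActsByLinChar ψ ν V ∧ 0 < Module.finrank ℂ V := by
  let S : Submodule ℂ (G → ℂ) :=
    { carrier := {f | ∀ r, (H.coord r).1 ∈ H.radical ψ → ∀ g, f (r * g) = H.linChar ψ ν r * f g}
      add_mem' := fun {a b} ha hb r hr g => by simp [ha r hr, hb r hr, mul_add]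
      zero_mem' := fun r hr g => by simp
      smul_mem' := fun c f hf r hr g => by simp [hf r hr, mul_left_comm] }
  let ρ : G →* (S →ₗ[ℂ] S) :=
    { toFun := fun h => (LinearMap.funLeft ℂ ℂ (· * h)).restrict (p := S) (q := S)
        fun f hf r hr g => by simp [LinearMap.funLeft_apply, mul_assoc, hf r hr]
      map_one' := by ext; simp [LinearMap.funLeft_apply]
      map_mul' := fun a b => by
        ext f g
        exact congrArg f.1 (mul_assoc g a b).symm }
  refine ⟨FDRep.of ρ, fun r hr => ?_, ?_⟩
  · rw [FDRep.of_ρ']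
    ext f g
    have hr' : (H.coord (g * r * g⁻¹)).1 ∈ H.radical ψ := by
      simpa [H.fst_mul, H.fst_inv] using hr
    have := f.2 _ hr' g
    rw [inv_mul_cancel_right, linChar_conj ν hr] at this
    exact this
  · have hmem : H.linChar ψ ν ∈ S := fun r hr g => linChar_mul ν hr g
    refine Module.finrank_pos_iff_exists_ne_zero.2 ⟨(⟨_, hmem⟩ : S), fun h0 => ?_⟩
    have := congrFun (congrArg Subtype.val h0) 1
    simp at this

variable (H) in
lemma exists_simple_actsByLinChar (ψ : AddChar Z ℂ) (ν : AddChar (H.radical ψ) ℂ) :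
    ∃ V, H.ActsByLinChar ψ ν V ∧ Simple V := by
  refine FDRep.exists_simple_of_exists_nontrivial _ (fun U V f hf hV g hg => ?_)
    (H.exists_actsByLinChar_nontrivial ψ ν)
  ext u
  apply hf
  rw [FDRep.hom_rho_apply, hV g hg]
  exact (map_smul f.hom.hom.hom _ u).symm

omit [Finite G] in
lemma linChar_mul_linChar_inv {ψ : AddChar Z ℂ} [DecidablePred (· ∈ H.radical ψ)]
    (ν : AddChar (H.radical ψ) ℂ) (g : G) : H.linChar ψ ν g * H.linChar ψ ν g⁻¹ =
      if (H.coord g).1 ∈ H.radical ψ then 1 else 0 := by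
  split_ifs with hg
  · rw [← linChar_mul ν hg, mul_inv_cancel, linChar_one]
  · rw [linChar_of_notMem ν hg, zero_mul]

/-- The degree of a simple representation is the square root of the index of the radical of its
central character. -/
lemma ActsByLinChar.finrank_sq_mul_card (h2 : ∀ w : W, ∃ w', w' + w' = w) {ψ : AddChar Z ℂ}
    {ν : AddChar (H.radical ψ) ℂ} {V : FDRep ℂ G} [Simple V] (hV : H.ActsByLinChar ψ ν V) :
    Module.finrank ℂ V ^ 2 * Nat.card (H.radical ψ) = Nat.card W := by
  classical
  have := Fintype.ofFinite G
  have : Finite (W × Z) := Finite.of_equiv G H.coord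
  have : Finite W := Finite.prod_left Z
  have : Finite Z := Finite.prod_right W
  have := Fintype.ofFinite W
  have := Fintype.ofFinite Z
  have h := V.simple_iff_char_is_norm_one.1 inferInstance
  have hχ : ∀ g, V.character g * V.character g⁻¹ = (Module.finrank ℂ V : ℂ) ^ 2 *
      if (H.coord g).1 ∈ H.radical ψ then 1 else 0 := fun g => by
    rw [hV.character_eq h2, ← linChar_mul_linChar_inv ν g]
    simp only [Pi.smul_apply, smul_eq_mul]
    ring
  rw [Finset.sum_congr rfl fun g _ => hχ g, ← Finset.mul_sum, ← H.coord.symm.sum_comp,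
    Fintype.sum_prod_type, Nat.card_congr H.coord, Nat.card_prod] at h
  simp only [Equiv.apply_symm_apply, Finset.sum_const, Finset.card_univ, nsmul_eq_mul] at h
  have hcard : (Finset.univ.filter (· ∈ H.radical ψ)).card = Nat.card (H.radical ψ) := by
    rw [Nat.card_eq_fintype_card, Fintype.card_subtype]
  rw [← Finset.mul_sum, Finset.sum_boole, hcard, Fintype.card_eq_nat_card] at h
  have hZ : 0 < Nat.card Z := Nat.card_pos
  norm_cast at h
  refine Nat.eq_of_mul_eq_mul_right hZ ?_
  rw [← h]
  ring

/-- The number of irreducible characters of degree `N`. -/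
lemma card_character_of_degree (h2 : ∀ w : W, ∃ w', w' + w' = w) {N c : ℕ}
    (hN : N ^ 2 * c = Nat.card W) :
    Nat.card {χ : G → ℂ | (∃ V : FDRep ℂ G, Simple V ∧ V.character = χ) ∧ χ 1 = N} =
      c * Nat.card {ψ : AddChar Z ℂ | Nat.card (H.radical ψ) = c} := by
  have : Finite (W × Z) := Finite.of_equiv G H.coord
  have : Finite W := Finite.prod_left Z
  have : Finite Z := Finite.prod_right W
  have hW : 0 < Nat.card W := Nat.card_pos
  have hN0 : 0 < N := by
    rw [Nat.pos_iff_ne_zero]; rintro rfl; simp at hN; omega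
  have hset : {χ : G → ℂ | (∃ V : FDRep ℂ G, Simple V ∧ V.character = χ) ∧ χ 1 = N} =
      (fun x : Σ ψ : AddChar Z ℂ, AddChar (H.radical ψ) ℂ => (N : ℂ) • H.linChar x.1 x.2) ''
        {x | Nat.card (H.radical x.1) = c} := by
    ext χ
    constructor
    · rintro ⟨⟨V, hV, rfl⟩, h1⟩
      obtain ⟨ψ, ν, hψ⟩ := H.exists_actsByLinChar V
      rw [FDRep.char_one, Nat.cast_inj] at h1
      refine ⟨⟨ψ, ν⟩, ?_, ?_⟩
      · have h := hψ.finrank_sq_mul_card h2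
        rw [h1, ← hN] at h
        exact Nat.eq_of_mul_eq_mul_left (by positivity) h
      · rw [hψ.character_eq h2, h1]
    · rintro ⟨⟨ψ, ν⟩, hc, rfl⟩
      obtain ⟨V, hV, hs⟩ := H.exists_simple_actsByLinChar ψ ν
      have h := hV.finrank_sq_mul_card h2
      have hc' : Nat.card (H.radical ψ) = c := hc
      have hc0 : 0 < c := hc' ▸ Nat.card_pos
      rw [hc', ← hN] at h
      have hdeg : Module.finrank ℂ V = N :=
        Nat.pow_left_injective (two_ne_zero) (Nat.eq_of_mul_eq_mul_right hc0 h)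
      exact ⟨⟨V, hs, by rw [hV.character_eq h2, hdeg]⟩, by simp⟩
  rw [hset, Nat.card_image_of_injective
    (H.smul_linChar_injective (Nat.cast_ne_zero.2 hN0.ne'))]
  let e : {x : Σ ψ : AddChar Z ℂ, AddChar (H.radical ψ) ℂ | Nat.card (H.radical x.1) = c} ≃
      Σ ψ : {ψ : AddChar Z ℂ // Nat.card (H.radical ψ) = c}, AddChar (H.radical ψ.1) ℂ :=
    { toFun := fun x => ⟨⟨x.1.1, x.2⟩, x.1.2⟩
      invFun := fun x => ⟨⟨x.1.1, x.2⟩, x.1.2⟩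
      left_inv := fun _ => rfl
      right_inv := fun _ => rfl }
  have hfib : ∀ ψ : {ψ : AddChar Z ℂ // Nat.card (H.radical ψ) = c},
      Nat.card (AddChar (H.radical ψ.1) ℂ) = c := fun ψ => by
    have := Fintype.ofFinite (H.radical ψ.1)
    rw [Nat.card_eq_fintype_card, AddChar.card_eq, ← Nat.card_eq_fintype_card, ψ.2]
  have := Fintype.ofFinite {ψ : AddChar Z ℂ // Nat.card (H.radical ψ) = c}
  rw [Nat.card_congr e, Nat.card_sigma]
  rw [Finset.sum_congr rfl fun ψ _ => hfib ψ, Finset.sum_const, Finset.card_univ, smul_eq_mul,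
    mul_comm, Fintype.card_eq_nat_card]
  rfl

end Characters

end HeisenbergChart

end HeisenbergGroups

namespace Matrix

section Skew

variable (I F : Type) [Field F]

/-- The space of skew-symmetric matrices. -/
def skewSubmodule : Submodule F (Matrix I I F) where
  carrier := {M | Mᵀ = -M}
  add_mem' {a b} ha hb := by
    simp only [Set.mem_ofPred_eq] at *
    rw [transpose_add, ha, hb, neg_add]
  zero_mem' := by simp
  smul_mem' c a ha := by
    simp only [Set.mem_ofPred_eq] at *
    rw [transpose_smul, ha, smul_neg]

variable {I F}

lemma mem_skewSubmodule {M : Matrix I I F} : M ∈ skewSubmodule I F ↔ Mᵀ = -M := Iff.rfl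

variable [Fintype I]

/-- A nonsingular skew-symmetric matrix has even size. -/
lemma even_card_of_transpose_eq_neg [DecidableEq I] (h2 : (2 : F) ≠ 0) {M : Matrix I I F}
    (hM : Mᵀ = -M) (hdet : M.det ≠ 0) : Even (Fintype.card I) := by
  by_contra hodd
  rw [Nat.not_even_iff_odd] at hodd
  have h : M.det = -M.det := by
    conv_lhs => rw [← det_transpose, hM, det_neg, hodd.neg_one_pow, neg_one_mul]
  have h' : 2 * M.det = 0 := by linear_combination h
  exact (mul_ne_zero h2 hdet) h'

/-- The rank of a skew-symmetric matrix is even. -/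
lemma even_rank_of_transpose_eq_neg (h2 : (2 : F) ≠ 0) {M : Matrix I I F}
    (hM : Mᵀ = -M) : Even M.rank := by
  classical
  obtain ⟨U, hU⟩ := Submodule.exists_isCompl (LinearMap.ker M.mulVecLin)
  have hrank : Module.finrank F U = M.rank := by
    have h1 := Submodule.finrank_add_eq_of_isCompl hU
    have h3 := M.mulVecLin.finrank_range_add_finrank_ker
    rw [Matrix.rank]
    omega
  let b := Module.finBasis F U
  let P : Matrix I (Fin (Module.finrank F U)) F := Matrix.of fun i j => (b j : I → F) i
  have hP : ∀ v, P *ᵥ v = ((∑ j, v j • b j : U) : I → F) := fun v => by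
    ext i
    simp [P, mulVec, dotProduct, mul_comm]
  have hN : (Pᵀ * M * P)ᵀ = -(Pᵀ * M * P) := by
    simp [transpose_mul, hM, Matrix.mul_assoc]
  have hdet : (Pᵀ * M * P).det ≠ 0 := by
    intro h0
    obtain ⟨v, hv, hv0⟩ := exists_mulVec_eq_zero_iff.2 h0
    rw [← mulVec_mulVec, ← mulVec_mulVec] at hv0
    have hMu : M *ᵥ (P *ᵥ v) = 0 := by
      refine dotProduct_eq_zero _ fun x => ?_
      have hx : x ∈ LinearMap.ker M.mulVecLin ⊔ U := by rw [hU.sup_eq_top]; trivial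
      obtain ⟨y, hy, u, hu, rfl⟩ := Submodule.mem_sup.1 hx
      have hy0 : M *ᵥ y = 0 := hy
      obtain ⟨c, hc⟩ : ∃ c, u = P *ᵥ c :=
        ⟨b.repr ⟨u, hu⟩, by rw [hP, b.sum_repr]⟩
      have hl : M *ᵥ (P *ᵥ v) ⬝ᵥ y = 0 := by
        rw [dotProduct_comm, dotProduct_mulVec, ← mulVec_transpose, hM, neg_mulVec, hy0]
        simp
      have hr : M *ᵥ (P *ᵥ v) ⬝ᵥ u = 0 := by
        rw [hc, dotProduct_mulVec, ← mulVec_transpose, hv0, zero_dotProduct]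
      rw [dotProduct_add, hl, hr, add_zero]
    have hmem : P *ᵥ v ∈ LinearMap.ker M.mulVecLin ⊓ U := ⟨hMu, by rw [hP]; exact Subtype.prop _⟩
    rw [hU.inf_eq_bot, Submodule.mem_bot, hP, ZeroMemClass.coe_eq_zero] at hmem
    exact hv (funext (Fintype.linearIndependent_iff.1 b.linearIndependent v hmem))
  rw [← hrank]
  simpa using even_card_of_transpose_eq_neg h2 hN hdet

/-- The number of solutions `A` of `M * A = 0`. -/
lemma card_mul_eq_zero {J : Type} [Fintype J] [Fintype F] (M : Matrix I I F) :
    Nat.card {A : Matrix I J F // M * A = 0} =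
      Fintype.card F ^ ((Fintype.card I - M.rank) * Fintype.card J) := by
  classical
  let e : {A : Matrix I J F // M * A = 0} ≃ (J → LinearMap.ker M.mulVecLin) :=
    { toFun := fun A j => ⟨A.1.col j, by
        ext i
        exact congrFun (congrFun A.2 i) j⟩
      invFun := fun v => ⟨Matrix.of fun i j => (v j).1 i, by
        ext i j
        exact congrFun (v j).2 i⟩
      left_inv := fun _ => rfl
      right_inv := fun _ => rfl }
  have h3 := M.mulVecLin.finrank_range_add_finrank_ker
  have hk : Module.finrank F (LinearMap.ker M.mulVecLin) = Fintype.card I - M.rank := by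
    rw [Module.finrank_fintype_fun_eq_card] at h3
    rw [Matrix.rank]
    omega
  rw [Nat.card_congr e, Nat.card_pi, Finset.prod_const, Finset.card_univ,
    Module.natCard_eq_pow_finrank (K := F), hk, ← pow_mul, Nat.card_eq_fintype_card]

lemma eq_zero_of_forall_trace_mul {J : Type} [Fintype J] {φ : AddChar F ℂ} (hφ : φ ≠ 1)
    {N : Matrix J I F} (h : ∀ X : Matrix I J F, φ (trace (N * X)) = 1) : N = 0 := by
  classical
  by_contra hN
  obtain ⟨j, i, hij⟩ : ∃ j i, N j i ≠ 0 := by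
    by_contra! h'
    exact hN (Matrix.ext h')
  obtain ⟨t, ht⟩ := (AddChar.ne_one_iff).1 hφ
  refine ht ?_
  have := h (Matrix.single i j ((N j i)⁻¹ * t))
  rwa [trace_mul_single, op_smul_eq_mul, mul_inv_cancel_left₀ hij] at this

variable (φ : AddChar F ℂ)

/-- The character of the space of skew-symmetric matrices given by the trace pairing with `M`. -/
def skewChar (M : skewSubmodule I F) : AddChar (skewSubmodule I F) ℂ where
  toFun z := φ (trace (M.1 * z.1))
  map_zero_eq_one' := by simp
  map_add_eq_mul' a b := by simp [Matrix.mul_add, AddChar.map_add_eq_mul]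

@[simp] lemma skewChar_apply (M z : skewSubmodule I F) :
    skewChar φ M z = φ (trace (M.1 * z.1)) := rfl

variable {φ}

lemma skewChar_injective (h2 : (2 : F) ≠ 0) (hφ : φ ≠ 1) :
    Function.Injective (skewChar φ : skewSubmodule I F → _) := by
  intro M M' h
  have key : (2 : F) • (M.1 - M'.1) = 0 := by
    refine eq_zero_of_forall_trace_mul hφ fun X => ?_
    have hX : X - Xᵀ ∈ skewSubmodule I F := by simp [mem_skewSubmodule]
    have hz := DFunLike.congr_fun h ⟨X - Xᵀ, hX⟩
    have ht : ∀ N : skewSubmodule I F, trace (N.1 * (X - Xᵀ)) = 2 * trace (N.1 * X) := fun N => by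
      have : trace (N.1 * Xᵀ) = -trace (N.1 * X) := by
        rw [← trace_transpose, transpose_mul, transpose_transpose, mem_skewSubmodule.1 N.2,
          Matrix.mul_neg, trace_neg, trace_mul_comm]
      rw [Matrix.mul_sub, trace_sub, this]
      ring
    simp only [skewChar_apply, ht] at hz
    have e : trace ((2 : F) • (M.1 - M'.1) * X) = 2 * trace (M.1 * X) - 2 * trace (M'.1 * X) := by
      simp [Matrix.sub_mul, mul_sub]
    rw [e, AddChar.map_sub_eq_div, hz, div_self (AddChar.val_isUnit φ _).ne_zero]
  exact Subtype.ext (sub_eq_zero.1 ((smul_eq_zero_iff_right h2).1 key))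

lemma skewChar_bijective [Finite F] (h2 : (2 : F) ≠ 0) (hφ : φ ≠ 1) :
    Function.Bijective (skewChar φ : skewSubmodule I F → _) := by
  have := Fintype.ofFinite F
  have := Fintype.ofFinite (skewSubmodule I F)
  classical
  rw [Fintype.bijective_iff_injective_and_card]
  exact ⟨skewChar_injective h2 hφ, AddChar.card_eq.symm⟩

end Skew

section Form

variable {I J F : Type} [Field F] [Fintype J]

/-- The alternating form on pairs of matrices with values in skew-symmetric matrices. -/
def skewForm : Matrix I J F × Matrix I J F →+ Matrix I J F × Matrix I J F →+
    skewSubmodule I F :=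
  AddMonoidHom.mk' (fun w => AddMonoidHom.mk' (fun w' =>
    ⟨(2⁻¹ : F) • (w'.2 * w.1ᵀ - w.1 * w'.2ᵀ + w'.1 * w.2ᵀ - w.2 * w'.1ᵀ), by
      rw [mem_skewSubmodule, ← smul_neg, transpose_smul]
      congr 1
      simp only [transpose_sub, transpose_add, transpose_mul, transpose_transpose]
      abel⟩) fun a b => by
        ext1
        simp only [Submodule.coe_add, ← smul_add, Prod.fst_add, Prod.snd_add, Matrix.add_mul,
          Matrix.mul_add, transpose_add]
        congr 1
        abel) fun a b => by
          ext1 w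
          ext1
          simp only [AddMonoidHom.mk'_apply, AddMonoidHom.add_apply, Submodule.coe_add,
            ← smul_add, Prod.fst_add, Prod.snd_add, Matrix.add_mul, Matrix.mul_add, transpose_add]
          congr 1
          abel

lemma coe_skewForm (w w' : Matrix I J F × Matrix I J F) : (skewForm w w' : Matrix I I F) =
    (2⁻¹ : F) • (w'.2 * w.1ᵀ - w.1 * w'.2ᵀ + w'.1 * w.2ᵀ - w.2 * w'.1ᵀ) := rfl

lemma skewForm_self (w : Matrix I J F × Matrix I J F) : skewForm w w = 0 := by
  ext1
  rw [coe_skewForm, sub_add_cancel, sub_self, smul_zero]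
  rfl

lemma trace_mul_skewForm [Fintype I] (h2 : (2 : F) ≠ 0) (M : skewSubmodule I F)
    (w w' : Matrix I J F × Matrix I J F) :
    trace (M.1 * (skewForm w w').1) = trace (w.1ᵀ * M.1 * w'.2) + trace (w.2ᵀ * M.1 * w'.1) := by
  have h₁ : ∀ A C : Matrix I J F, trace (M.1 * (C * Aᵀ)) = trace (Aᵀ * M.1 * C) := fun A C => by
    rw [← Matrix.mul_assoc, trace_mul_comm, Matrix.mul_assoc]
  have h₂ : ∀ A C : Matrix I J F, trace (M.1 * (A * Cᵀ)) = -trace (Aᵀ * M.1 * C) := fun A C => by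
    rw [h₁ C A, ← trace_transpose, transpose_mul, transpose_mul, mem_skewSubmodule.1 M.2,
      transpose_transpose, ← trace_neg, Matrix.neg_mul, Matrix.mul_neg, Matrix.mul_assoc]
  rw [coe_skewForm, Matrix.mul_smul, trace_smul, Matrix.mul_sub, Matrix.mul_add, Matrix.mul_sub,
    trace_sub, trace_add, trace_sub, h₁ w.1, h₂ w.1, h₁ w.2, h₂ w.2,
    smul_eq_mul]
  field_simp
  ring

end Form

end Matrix

namespace HeisenbergChart

open Matrix

variable {G I J F : Type} [Group G] [Field F] [Fintype I] [Fintype J]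
  {H : HeisenbergChart G (Matrix I J F × Matrix I J F) (skewSubmodule I F)}

lemma mem_radical_skewChar (hH : H.form = skewForm) (h2 : (2 : F) ≠ 0) {φ : AddChar F ℂ}
    (hφ : φ ≠ 1) (M : skewSubmodule I F) {w : Matrix I J F × Matrix I J F} :
    w ∈ H.radical (skewChar φ M) ↔ M.1 * w.1 = 0 ∧ M.1 * w.2 = 0 := by
  have ht : ∀ A : Matrix I J F, Aᵀ * M.1 = 0 ↔ M.1 * A = 0 := fun A => by
    rw [← transpose_eq_zero, transpose_mul, transpose_transpose, mem_skewSubmodule.1 M.2,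
      Matrix.neg_mul, neg_eq_zero]
  simp only [mem_radical, hH, skewChar_apply, trace_mul_skewForm h2, ← ht]
  refine ⟨fun h => ⟨eq_zero_of_forall_trace_mul hφ fun X => ?_,
    eq_zero_of_forall_trace_mul hφ fun X => ?_⟩, fun h w' => by simp [h.1, h.2]⟩
  · simpa using h (0, X)
  · simpa using h (X, 0)

lemma card_radical_skewChar [Fintype F] (hH : H.form = skewForm) (h2 : (2 : F) ≠ 0)
    {φ : AddChar F ℂ} (hφ : φ ≠ 1) (M : skewSubmodule I F) :
    Nat.card (H.radical (skewChar φ M)) =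
      Fintype.card F ^ (2 * ((Fintype.card I - M.1.rank) * Fintype.card J)) := by
  let e : H.radical (skewChar φ M) ≃
      {A : Matrix I J F // M.1 * A = 0} × {A : Matrix I J F // M.1 * A = 0} :=
    { toFun := fun w => (⟨w.1.1, ((mem_radical_skewChar hH h2 hφ M).1 w.2).1⟩,
        ⟨w.1.2, ((mem_radical_skewChar hH h2 hφ M).1 w.2).2⟩)
      invFun := fun x => ⟨(x.1.1, x.2.1), (mem_radical_skewChar hH h2 hφ M).2 ⟨x.1.2, x.2.2⟩⟩
      left_inv := fun _ => rfl
      right_inv := fun _ => rfl }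
  rw [Nat.card_congr e, Nat.card_prod, card_mul_eq_zero, ← pow_add, ← two_mul]

end HeisenbergChart

namespace SOUnipotentRadical

section Coordinates

variable {I J F : Type} [Fintype I] [Fintype J] [DecidableEq I] [DecidableEq J] [Field F]

/-- Elements of the unipotent radical in coordinates adapted to the commutator form. -/
def radicalMatrix (w : Matrix I J F × Matrix I J F) (z : Matrix I I F) :
    Matrix ((I ⊕ J) ⊕ (I ⊕ J)) ((I ⊕ J) ⊕ (I ⊕ J)) F :=
  fromBlocks (fromBlocks 1 w.1 0 1)
    (fromBlocks (z - (2⁻¹ : F) • (w.1 * w.2ᵀ + w.2 * w.1ᵀ)) w.2 (-w.2ᵀ) 0) 0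
    (fromBlocks 1 0 (-w.1ᵀ) 1)

lemma radicalMatrix_mul (h2 : (2 : F) ≠ 0) (w w' : Matrix I J F × Matrix I J F)
    (z z' : Matrix I I F) :
    radicalMatrix w z * radicalMatrix w' z' =
      radicalMatrix (w + w') (z + z' + (skewForm w w' : Matrix I I F)) := by
  have key : z' - (2⁻¹ : F) • (w'.1 * w'.2ᵀ + w'.2 * w'.1ᵀ) + w.1 * -w'.2ᵀ +
      (z - (2⁻¹ : F) • (w.1 * w.2ᵀ + w.2 * w.1ᵀ) + w.2 * -w'.1ᵀ) =
      z + z' + (skewForm w w' : Matrix I I F) -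
        (2⁻¹ : F) • ((w.1 + w'.1) * (w.2 + w'.2)ᵀ + (w.2 + w'.2) * (w.1 + w'.1)ᵀ) := by
    have hh : ∀ X : Matrix I I F, X = (2⁻¹ : F) • X + (2⁻¹ : F) • X := fun X => by
      rw [← add_smul, ← two_mul, mul_inv_cancel₀ h2, one_smul]
    rw [hh (w.1 * -w'.2ᵀ), hh (w.2 * -w'.1ᵀ), coe_skewForm]
    simp only [transpose_add, Matrix.add_mul, Matrix.mul_add, Matrix.mul_neg, smul_add, smul_sub,
      smul_neg]
    abel
  simp only [radicalMatrix, fromBlocks_multiply, Matrix.one_mul, Matrix.mul_one, Matrix.zero_mul,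
    Matrix.mul_zero, add_zero, zero_add, fromBlocks_add, fromBlocks_inj, Prod.fst_add,
    Prod.snd_add, transpose_add, key, true_and, and_true]
  exact ⟨add_comm _ _, ⟨add_comm _ _, by abel⟩, by abel⟩

omit [Fintype I] in
lemma radicalMatrix_injective : Function.Injective fun x : (Matrix I J F × Matrix I J F) ×
    skewSubmodule I F => radicalMatrix x.1 x.2.1 := by
  rintro ⟨⟨A, C⟩, z⟩ ⟨⟨A', C'⟩, z'⟩ h
  simp only [radicalMatrix, fromBlocks_inj] at h
  obtain ⟨⟨-, rfl, -⟩, ⟨hz, rfl, -⟩, -⟩ := h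
  rw [sub_left_inj] at hz
  rw [Subtype.ext hz]

lemma isUnit_radicalMatrix (w : Matrix I J F × Matrix I J F) (z : Matrix I I F) :
    IsUnit (radicalMatrix w z) := by
  rw [isUnit_iff_isUnit_det, radicalMatrix, det_fromBlocks_zero₂₁, det_fromBlocks_zero₂₁,
    det_fromBlocks_zero₁₂]
  simp

end Coordinates

section Chart

variable {F : Type} [Field F] {n d : ℕ}

lemma transpose_Umat_inv (A : Matrix (Fin d) (Fin (n - d)) F) :
    ((Umat F n d A)ᵀ)⁻¹ = fromBlocks 1 0 (-Aᵀ) 1 := by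
  refine inv_eq_right_inv ?_
  simp [Umat, fromBlocks_transpose, fromBlocks_multiply]

lemma mem_RuD_iff (h2 : (2 : F) ≠ 0) {g : Matrix (κ n d) (κ n d) F} :
    g ∈ RuD F n d ↔ ∃ (w : Matrix (Fin d) (Fin (n - d)) F × Matrix (Fin d) (Fin (n - d)) F)
      (z : skewSubmodule (Fin d) F), radicalMatrix w z.1 = g := by
  have hh : ∀ X : Matrix (Fin d) (Fin d) F, X = (2⁻¹ : F) • X + (2⁻¹ : F) • X := fun X => by
    rw [← add_smul, ← two_mul, mul_inv_cancel₀ h2, one_smul]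
  have hmat : ∀ (A C : Matrix (Fin d) (Fin (n - d)) F) (B : Matrix (Fin d) (Fin d) F),
      fromBlocks (Umat F n d A) (fromBlocks B C (-Cᵀ) 0 * ((Umat F n d A)ᵀ)⁻¹) 0
        ((Umat F n d A)ᵀ)⁻¹ =
      radicalMatrix (A, C) (B + (2⁻¹ : F) • (A * Cᵀ - C * Aᵀ)) := fun A C B => by
    rw [transpose_Umat_inv, radicalMatrix, Umat, fromBlocks_multiply]
    have e : B + C * -Aᵀ =
        B + (2⁻¹ : F) • (A * Cᵀ - C * Aᵀ) - (2⁻¹ : F) • (A * Cᵀ + C * Aᵀ) := by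
      rw [hh (C * -Aᵀ)]
      simp only [Matrix.mul_neg, smul_add, smul_sub, smul_neg]
      abel
    rw [Matrix.mul_one B, e]
    simp
  have hskew : ∀ A C : Matrix (Fin d) (Fin (n - d)) F,
      (2⁻¹ : F) • (A * Cᵀ - C * Aᵀ) ∈ skewSubmodule (Fin d) F := fun A C => by
    refine Submodule.smul_mem _ _ ?_
    simp [mem_skewSubmodule]
  constructor
  · rintro ⟨A, V, ⟨hV, hV0⟩, rfl⟩
    rw [← fromBlocks_toBlocks V, fromBlocks_transpose, fromBlocks_neg, fromBlocks_inj] at hV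
    have hV' : V = fromBlocks V.toBlocks₁₁ V.toBlocks₁₂ (-V.toBlocks₁₂ᵀ) 0 := by
      conv_lhs => rw [← fromBlocks_toBlocks V]
      rw [hV.2.2.1, neg_neg, fromBlocks_inj]
      exact ⟨rfl, rfl, rfl, Matrix.ext hV0⟩
    rw [hV', hmat]
    exact ⟨_, ⟨_, add_mem (mem_skewSubmodule.2 hV.1) (hskew _ _)⟩, rfl⟩
  · rintro ⟨⟨A, C⟩, z, rfl⟩
    refine ⟨A, fromBlocks (z.1 - (2⁻¹ : F) • (A * Cᵀ - C * Aᵀ)) C (-Cᵀ) 0, ⟨?_, fun i j => rfl⟩, ?_⟩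
    · have := mem_skewSubmodule.1 (sub_mem z.2 (hskew A C))
      rw [fromBlocks_transpose, this, fromBlocks_neg]
      simp
    · rw [hmat, sub_add_cancel]

/-- The unipotent radical is a group of Heisenberg type. -/
lemma exists_chart (h2 : (2 : F) ≠ 0) (G : Subgroup (Matrix (κ n d) (κ n d) F)ˣ)
    (hG : ∀ u : (Matrix (κ n d) (κ n d) F)ˣ,
      u ∈ G ↔ (u : Matrix (κ n d) (κ n d) F) ∈ RuD F n d) :
    ∃ H : HeisenbergChart G
      (Matrix (Fin d) (Fin (n - d)) F × Matrix (Fin d) (Fin (n - d)) F)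
      (skewSubmodule (Fin d) F), H.form = skewForm := by
  let f : (Matrix (Fin d) (Fin (n - d)) F × Matrix (Fin d) (Fin (n - d)) F) ×
      skewSubmodule (Fin d) F → G := fun x =>
    ⟨(isUnit_radicalMatrix x.1 x.2.1).unit, (hG _).2 ((mem_RuD_iff h2).2 ⟨x.1, x.2, rfl⟩)⟩
  have hf : ∀ x, ((f x : (Matrix (κ n d) (κ n d) F)ˣ) : Matrix (κ n d) (κ n d) F) =
      radicalMatrix x.1 x.2.1 := fun x => rfl
  have hbij : Function.Bijective f := by
    refine ⟨fun x y h => radicalMatrix_injective ?_, fun g => ?_⟩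
    · simp only [← hf, h]
    · obtain ⟨w, z, h⟩ := (mem_RuD_iff h2).1 ((hG g.1).1 g.2)
      exact ⟨(w, z), Subtype.ext (Units.ext h)⟩
  let e := Equiv.ofBijective f hbij
  have hmul : ∀ x y, f x * f y = f (x.1 + y.1, x.2 + y.2 + skewForm x.1 y.1) := fun x y =>
    Subtype.ext (Units.ext (radicalMatrix_mul h2 _ _ _ _))
  have hcoord : ∀ g h, e.symm (g * h) = ((e.symm g).1 + (e.symm h).1,
      (e.symm g).2 + (e.symm h).2 + skewForm (e.symm g).1 (e.symm h).1) := fun g h => by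
    rw [Equiv.symm_apply_eq]
    have := hmul (e.symm g) (e.symm h)
    rwa [show f (e.symm g) = g from e.apply_symm_apply g,
      show f (e.symm h) = h from e.apply_symm_apply h] at this
  exact ⟨⟨e.symm, skewForm, skewForm_self, fun g h => by rw [hcoord], fun g h => by rw [hcoord]⟩,
    rfl⟩

end Chart

/-- the number of irreducible characters of `R_u^{D,d}` of degree
`q^{2(n−d)s}` equals `q^{2d(n−d)−4(n−d)s}` times the number of skew-symmetric `d×d`
matrices over `F_q` of rank `2s`; moreover every irreducible character of `R_u^{D,d}`
has degree `q^{2(n−d)s}` for some `0 ≤ 2s ≤ d`. -/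
theorem ruD_char_count
    (p k q : ℕ) (hp : p.Prime) (hpodd : Odd p) (hk : 1 ≤ k) (hq : q = p ^ k)
    (F : Type) [Field F] [Fintype F] (hF : Fintype.card F = q)
    (n d : ℕ) (hd : 1 ≤ d) (hdn : d < n - 1)
    (G : Subgroup (Matrix (κ n d) (κ n d) F)ˣ)
    (hG : ∀ u : (Matrix (κ n d) (κ n d) F)ˣ,
      u ∈ G ↔ (u : Matrix (κ n d) (κ n d) F) ∈ RuD F n d)
    (s : ℕ) (hs : 2 * s ≤ d) :
    Nat.card {χ : ↥G → ℂ |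
        (∃ V : FDRep ℂ ↥G, CategoryTheory.Simple V ∧ FDRep.character V = χ) ∧
        χ 1 = (q : ℂ) ^ (2 * (n - d) * s)} =
      q ^ (2 * d * (n - d) - 4 * (n - d) * s) *
        Nat.card {M : Matrix (Fin d) (Fin d) F | Mᵀ = -M ∧ M.rank = 2 * s} ∧
    ∀ V : FDRep ℂ ↥G, CategoryTheory.Simple V →
      ∃ s' : ℕ, 2 * s' ≤ d ∧ FDRep.character V 1 = (q : ℂ) ^ (2 * (n - d) * s') := by
  classical
  have h2 : (2 : F) ≠ 0 := Ring.two_ne_zero fun h => by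
    have h0 := FiniteField.even_card_iff_char_two.1 h
    have h1 := Nat.odd_iff.1 (hpodd.pow (n := k))
    rw [hF, hq] at h0
    omega
  obtain ⟨H, hH⟩ := exists_chart h2 G hG
  have hW2 : ∀ w : Matrix (Fin d) (Fin (n - d)) F × Matrix (Fin d) (Fin (n - d)) F,
      ∃ w', w' + w' = w := fun w =>
    ⟨(2⁻¹ : F) • w, by rw [← add_smul, ← two_mul, mul_inv_cancel₀ h2, one_smul]⟩
  obtain ⟨φ, hφ1⟩ := (AddChar.exists_apply_ne_zero (a := (1 : F))).2 one_ne_zero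
  have hφ : φ ≠ 1 := fun h => hφ1 (by rw [h]; rfl)
  have hbij := skewChar_bijective (I := Fin d) h2 hφ
  have hq1 : 1 < q := hF ▸ Fintype.one_lt_card
  have hm : 0 < n - d := by omega
  have hrank : ∀ M : skewSubmodule (Fin d) F, M.1.rank ≤ d := fun M => by
    simpa using M.1.rank_le_card_height
  have hrad : ∀ M : skewSubmodule (Fin d) F, Nat.card (H.radical (skewChar φ M)) =
      q ^ (2 * ((d - M.1.rank) * (n - d))) := fun M => by
    simpa [hF] using HeisenbergChart.card_radical_skewChar hH h2 hφ M
  have hW : Nat.card (Matrix (Fin d) (Fin (n - d)) F × Matrix (Fin d) (Fin (n - d)) F) =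
      q ^ (2 * (d * (n - d))) := by
    rw [Module.natCard_eq_pow_finrank (K := F), Nat.card_eq_fintype_card, hF]
    simp [Module.finrank_matrix, two_mul]
  constructor
  · have hexp : 2 * d * (n - d) - 4 * (n - d) * s = 2 * ((d - 2 * s) * (n - d)) := by
      obtain ⟨t, rfl⟩ := Nat.exists_eq_add_of_le hs
      rw [Nat.add_sub_cancel_left, Nat.sub_eq_iff_eq_add (by nlinarith)]
      ring
    have hN : (q ^ (2 * (n - d) * s)) ^ 2 * q ^ (2 * ((d - 2 * s) * (n - d))) =
        Nat.card (Matrix (Fin d) (Fin (n - d)) F × Matrix (Fin d) (Fin (n - d)) F) := by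
      rw [hW, ← pow_mul, ← pow_add]
      congr 1
      obtain ⟨t, ht⟩ := Nat.exists_eq_add_of_le hs
      rw [Nat.sub_eq_of_eq_add' ht]
      generalize n - d = m
      rw [ht]
      ring
    have hcount := H.card_character_of_degree hW2 hN
    push_cast at hcount
    rw [hcount, hexp]
    congr 1
    have hiff : ∀ M : skewSubmodule (Fin d) F,
        Nat.card (H.radical (skewChar φ M)) = q ^ (2 * ((d - 2 * s) * (n - d))) ↔
          M.1.rank = 2 * s := fun M => by
      have := hrank M
      rw [hrad, (Nat.pow_right_injective hq1).eq_iff, Nat.mul_right_inj two_ne_zero,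
        Nat.mul_left_inj hm.ne']
      omega
    refine (Nat.card_congr (Equiv.ofBijective
      (fun M => ⟨skewChar φ ⟨M.1, M.2.1⟩, (hiff _).2 M.2.2⟩) ⟨fun M M' h => ?_, ?_⟩)).symm
    · exact Subtype.ext (Subtype.mk.inj (hbij.1 (congrArg Subtype.val h)))
    · rintro ⟨ψ, hψ⟩
      obtain ⟨M, rfl⟩ := hbij.2 ψ
      exact ⟨⟨M.1, M.2, (hiff M).1 hψ⟩, rfl⟩
  · intro V hV
    obtain ⟨ψ, ν, hψ⟩ := H.exists_actsByLinChar V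
    obtain ⟨M, rfl⟩ := hbij.2 ψ
    obtain ⟨r, hr⟩ := even_rank_of_transpose_eq_neg h2 (mem_skewSubmodule.1 M.2)
    have hrd := hrank M
    have hdeg := hψ.finrank_sq_mul_card hW2
    rw [hrad, hW] at hdeg
    refine ⟨r, by omega, ?_⟩
    have hsq : (q ^ (2 * (n - d) * r)) ^ 2 * q ^ (2 * ((d - M.1.rank) * (n - d))) =
        q ^ (2 * (d * (n - d))) := by
      rw [← pow_mul, ← pow_add]
      congr 1
      obtain ⟨t, ht⟩ := Nat.exists_eq_add_of_le hrd
      rw [Nat.sub_eq_of_eq_add' ht]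
      generalize n - d = m
      rw [ht, hr]
      ring
    have hpos : 0 < q ^ (2 * ((d - M.1.rank) * (n - d))) := by positivity
    have hfin : Module.finrank ℂ V = q ^ (2 * (n - d) * r) :=
      Nat.pow_left_injective two_ne_zero (Nat.eq_of_mul_eq_mul_right hpos (hdeg.trans hsq.symm))
    rw [FDRep.char_one, hfin, Nat.cast_pow]

end SOUnipotentRadical
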